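/- arXiv:2501.03219 — 3 statements merged into one kernel-verified Lean document; each statement's English description precedes it below -/
import Mathlib

section
/- Let n be a natural number and let M be an n × n symmetric matrix with integer entries that is unimodular (det M = 1 or det M = −1) and even (every diagonal entry M i i is even; equivalently, the integer xᵀ M x is even for every integer vector x). Then the signature of M is divisible by 8, where the signature is defined as the number of positive eigenvalues minus the number of negative eigenvalues, counted with multiplicity, of the real symmetric matrix obtained from M by mapping its entries into ℝ. -/
open Matrix Complex Filter Topology
open scoped Real

theorem Matrix.IsSymm.exists_transpose_mul_mul_eq_diagonal {K : Type*} [Field K] [Invertible (2 : K)]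
    {n : ℕ} {A : Matrix (Fin n) (Fin n) K} (hA : A.IsSymm) :
    ∃ (P : Matrix (Fin n) (Fin n) K) (w : Fin n → K), IsUnit P.det ∧ Pᵀ * A * P = diagonal w := by
  have hB : LinearMap.IsSymm (Matrix.toBilin' A) := by
    refine ⟨fun x y => ?_⟩
    simp only [Matrix.toBilin'_apply', RingHom.id_apply]
    rw [dotProduct_mulVec, ← mulVec_transpose, hA.eq, dotProduct_comm]
  obtain ⟨v, hv⟩ := LinearMap.BilinForm.exists_orthogonal_basis hB
  let b := v.reindex (finCongr (Module.finrank_fin_fun K : Module.finrank K (Fin n → K) = n))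
  refine ⟨(Pi.basisFun K (Fin n)).toMatrix b,
    fun i => LinearMap.BilinForm.toMatrix b (Matrix.toBilin' A) i i, ?_, ?_⟩
  · have := (Pi.basisFun K (Fin n)).invertibleToMatrix b
    exact (Matrix.isUnit_iff_isUnit_det _).1 (isUnit_of_invertible _)
  · have h := LinearMap.BilinForm.toMatrix_mul_basis_toMatrix (Pi.basisFun K (Fin n)) b
      (Matrix.toBilin' A)
    rw [LinearMap.BilinForm.toMatrix_basisFun, LinearMap.BilinForm.toMatrix'_toBilin'] at h
    rw [h]
    ext i j
    rcases eq_or_ne i j with rfl | hij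
    · simp
    · rw [diagonal_apply_ne _ hij, LinearMap.BilinForm.toMatrix_apply]
      simp only [b, Module.Basis.reindex_apply]
      exact hv (by simpa using hij)

theorem Matrix.map_intCast_transpose_mul_mul {K ι : Type*} [CommRing K] [Fintype ι]
    (P M : Matrix ι ι ℤ) : (Pᵀ * M * P).map (Int.cast : ℤ → K) =
      (P.map (Int.cast : ℤ → K))ᵀ * M.map (Int.cast : ℤ → K) * P.map (Int.cast : ℤ → K) := by
  change (Pᵀ * M * P).map (Int.castRingHom K) = _
  rw [Matrix.map_mul, Matrix.map_mul, transpose_map]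
  rfl

theorem Matrix.IsSymm.exists_int_transpose_mul_mul_eq_diagonal {n : ℕ}
    {M : Matrix (Fin n) (Fin n) ℤ} (hM : M.IsSymm) :
    ∃ (P : Matrix (Fin n) (Fin n) ℤ) (d : Fin n → ℤ), P.det ≠ 0 ∧ Pᵀ * M * P = diagonal d := by
  obtain ⟨P, w, hP, hw⟩ :=
    (hM.map (Int.cast : ℤ → ℚ)).exists_transpose_mul_mul_eq_diagonal
  obtain ⟨⟨b, hb⟩, hbP⟩ := IsLocalization.exist_integer_multiples_of_finite (nonZeroDivisors ℤ)
    (fun ij : Fin n × Fin n => P ij.1 ij.2)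
  choose Q hQ using hbP
  let P' : Matrix (Fin n) (Fin n) ℤ := Matrix.of fun i j => Q (i, j)
  have hP' : P'.map (Int.cast : ℤ → ℚ) = (b : ℚ) • P := by
    ext i j
    simpa [P'] using hQ (i, j)
  have hb0 : (b : ℚ) ≠ 0 := by simpa using nonZeroDivisors.ne_zero hb
  have key : (P'ᵀ * M * P').map (Int.cast : ℤ → ℚ) = diagonal fun i => (b : ℚ) ^ 2 * w i := by
    rw [map_intCast_transpose_mul_mul, hP', transpose_smul, Matrix.smul_mul, Matrix.smul_mul, Matrix.mul_smul, hw]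
    ext i j
    rcases eq_or_ne i j with rfl | hij
    · simp; ring
    · simp [hij]
  refine ⟨P', fun i => (P'ᵀ * M * P') i i, fun h0 => ?_, ?_⟩
  · have : ((b : ℚ) • P).det = 0 := by
      rw [← hP']
      simpa [h0] using ((Int.castRingHom ℚ).map_det P').symm
    rw [det_smul] at this
    exact mul_ne_zero (pow_ne_zero _ hb0) hP.ne_zero this
  · ext i j
    rcases eq_or_ne i j with rfl | hij
    · simp
    · have := congrFun₂ key i j
      simpa [hij] using this

theorem Matrix.equivalent_weightedSumSquares {K ι : Type*} [Field K] [Fintype ι] [DecidableEq ι]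
    {A P : Matrix ι ι K} {w : ι → K} (hP : IsUnit P.det) (h : Pᵀ * A * P = diagonal w) :
    QuadraticMap.Equivalent A.toQuadraticForm' (QuadraticMap.weightedSumSquares K w) := by
  refine QuadraticMap.Equivalent.symm ⟨⟨Matrix.toLinearEquiv' P (P.invertibleOfIsUnitDet hP), fun x => ?_⟩⟩
  have : (P *ᵥ x) ⬝ᵥ A *ᵥ (P *ᵥ x) = x ⬝ᵥ diagonal w *ᵥ x := by
    rw [← h, ← mulVec_mulVec, ← mulVec_mulVec, dotProduct_mulVec x, vecMul_transpose]
  simp only [QuadraticMap.weightedSumSquares_apply]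
  refine (?_ : _ = (P *ᵥ x) ⬝ᵥ A *ᵥ (P *ᵥ x)).trans (this.trans ?_)
  · simp [Matrix.toQuadraticForm', LinearMap.BilinMap.toQuadraticMap_apply, Matrix.toLinearMap₂'_apply']
  · simp only [dotProduct, mulVec_diagonal, smul_eq_mul]
    exact Finset.sum_congr rfl fun i _ => by ring

theorem Matrix.IsHermitian.equivalent_weightedSumSquares {ι : Type*} [Fintype ι] [DecidableEq ι]
    {A : Matrix ι ι ℝ} (hA : A.IsHermitian) :
    QuadraticMap.Equivalent A.toQuadraticForm' (QuadraticMap.weightedSumSquares ℝ hA.eigenvalues) := by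
  refine Matrix.equivalent_weightedSumSquares (P := hA.eigenvectorUnitary) ?_ ?_
  · exact (Matrix.isUnit_iff_isUnit_det _).1 (Unitary.toUnits hA.eigenvectorUnitary).isUnit
  · have := hA.conjStarAlgAut_star_eigenvectorUnitary
    rw [Unitary.conjStarAlgAut_star_apply] at this
    exact this

theorem Matrix.IsHermitian.card_eigenvalues_of_diagonal {ι : Type*} [Fintype ι] [DecidableEq ι]
    {A P : Matrix ι ι ℝ} {w : ι → ℝ} (hA : A.IsHermitian) (hP : IsUnit P.det)
    (h : Pᵀ * A * P = diagonal w) :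
    (Finset.univ.filter fun i => 0 < hA.eigenvalues i).card =
        (Finset.univ.filter fun i => 0 < w i).card ∧
      (Finset.univ.filter fun i => hA.eigenvalues i < 0).card =
        (Finset.univ.filter fun i => w i < 0).card := by
  have h1 := hA.equivalent_weightedSumSquares
  have h2 := Matrix.equivalent_weightedSumSquares hP h
  have hp := (QuadraticForm.sigPos_of_equiv_weightedSumSquares h1).symm.trans
    (QuadraticForm.sigPos_of_equiv_weightedSumSquares h2)
  have hn := (QuadraticForm.sigNeg_of_equiv_weightedSumSquares h1).symm.trans
    (QuadraticForm.sigNeg_of_equiv_weightedSumSquares h2)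
  simp only [← Set.ncard_coe_finset, Finset.coe_filter, Finset.mem_univ, true_and]
  exact ⟨hp, hn⟩

theorem AddChar.map_finset_sum {A S ι : Type*} [AddCommMonoid A] [CommMonoid S] [Fintype ι]
    (ψ : AddChar A S) (f : ι → A) : ψ (∑ i, f i) = ∏ i, ψ (f i) :=
  map_prod ψ.toMonoidHom (fun i => Multiplicative.ofAdd (f i)) _

theorem AddChar.IsPrimitive.sum_dotProduct {R S ι : Type*} [CommRing R] [Fintype R] [DecidableEq R] [CommRing S]
    [IsDomain S] [Fintype ι] [DecidableEq ι] {ψ : AddChar R S} (hψ : ψ.IsPrimitive) (v : ι → R) :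
    ∑ x : ι → R, ψ (v ⬝ᵥ x) = if v = 0 then (Fintype.card R : S) ^ Fintype.card ι else 0 := by
  have h : ∑ x : ι → R, ψ (v ⬝ᵥ x) = ∏ i, ∑ t : R, ψ (t * v i) := by
    rw [Finset.prod_univ_sum, Fintype.piFinset_univ]
    refine Finset.sum_congr rfl fun x _ => ?_
    simp only [dotProduct, mul_comm (x _)]
    exact AddChar.map_finset_sum ψ _
  simp_rw [h, AddChar.sum_mulShift _ hψ]
  split_ifs with hv
  · simp [hv]
  · obtain ⟨i, hi⟩ := Function.ne_iff.1 hv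
    exact Finset.prod_eq_zero (Finset.mem_univ i) (by rw [if_neg (by simpa using hi), Nat.cast_zero])

/-- A Gauss sum attached to a quadratic function `q` on a finite module is a positive integer as
soon as `q` has a self-dual isotropic subgroup (here, the range of `f`). -/
theorem sum_eq_card_of_isotropic {R S ι V : Type*} [CommRing R] [Fintype R] [CommRing S]
    [IsDomain S] [CharZero S] [Fintype ι] [Fintype V] [DecidableEq V] [AddCommGroup V]
    {ψ : AddChar R S} (hψ : ψ.IsPrimitive) (q : V → R)
    (f : (ι → R) → V) (c : V → ι → R)
    (hadd : ∀ a x, q (a + f x) = q a + c a ⬝ᵥ x)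
    (hzero : ∀ a, c a = 0 → q a = 0) [DecidablePred fun a => c a = 0] :
    ∑ a, ψ (q a) = (Finset.univ.filter fun a => c a = 0).card := by
  classical
  have h : ((Fintype.card R : S) ^ Fintype.card ι) * ∑ a, ψ (q a) =
      (Fintype.card R : S) ^ Fintype.card ι * (Finset.univ.filter fun a => c a = 0).card := by
    calc ((Fintype.card R : S) ^ Fintype.card ι) * ∑ a, ψ (q a)
        = ∑ x : ι → R, ∑ a, ψ (q a) := by simp
      _ = ∑ x : ι → R, ∑ a, ψ (q (a + f x)) :=
          Finset.sum_congr rfl fun x _ => (Equiv.sum_comp (Equiv.addRight (f x)) fun a => ψ (q a)).symm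
      _ = ∑ a, ψ (q a) * ∑ x : ι → R, ψ (c a ⬝ᵥ x) := by
          rw [Finset.sum_comm]
          simp_rw [hadd, AddChar.map_add_eq_mul, Finset.mul_sum]
      _ = ∑ a, if c a = 0 then (Fintype.card R : S) ^ Fintype.card ι else 0 := by
          refine Finset.sum_congr rfl fun a _ => ?_
          rw [hψ.sum_dotProduct]
          split_ifs with ha
          · rw [hzero a ha, AddChar.map_zero_eq_one, one_mul]
          · rw [mul_zero]
      _ = _ := by
          rw [← Finset.sum_filter, Finset.sum_const, nsmul_eq_mul, mul_comm]
  exact mul_left_cancel₀ (pow_ne_zero _ (Nat.cast_ne_zero.2 Fintype.card_ne_zero)) h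

/-- If an integral matrix `P` diagonalizes an even unimodular form to `diagonal d`, then the Gauss
sum of the discriminant form of `diagonal d` is a positive integer: the unimodular lattice is a
self-dual isotropic subgroup. -/
theorem exists_sum_stdAddChar_eq_natCast {ι : Type*} [Fintype ι] [DecidableEq ι] {M P : Matrix ι ι ℤ}
    {d e : ι → ℤ} {N : ℕ} [NeZero N] (hsym : M.IsSymm) (hdet : IsUnit M.det)
    (heven : ∀ x : ι → ℤ, Even (x ⬝ᵥ M *ᵥ x)) (hP : Pᵀ * M * P = diagonal d)
    (hde : ∀ i, 2 * e i * d i = N) :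
    ∃ k : ℕ, 0 < k ∧ ∑ a : ι → ZMod N, ZMod.stdAddChar (∑ i, (e i : ZMod N) * a i ^ 2) = (k : ℂ) := by
  classical
  have hN : (N : ℤ) ≠ 0 := by exact_mod_cast NeZero.ne N
  have hE : diagonal (2 * e) * diagonal d = (N : ℤ) • (1 : Matrix ι ι ℤ) := by
    rw [diagonal_mul_diagonal, ← diagonal_one, ← diagonal_smul]
    congr 1; ext i; simpa using hde i
  -- `C` is `N` times the inverse of `P`
  set C : Matrix ι ι ℤ := diagonal (2 * e) * (Pᵀ * M) with hC
  have hCP : C * P = (N : ℤ) • (1 : Matrix ι ι ℤ) := by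
    rw [hC, Matrix.mul_assoc, hP, hE]
  have hPdet : P.det ≠ 0 := by
    intro h0
    have := congrArg det hCP
    rw [det_mul, h0, mul_zero, det_smul, det_one, mul_one] at this
    exact pow_ne_zero _ hN this.symm
  have hPC : P * C = (N : ℤ) • (1 : Matrix ι ι ℤ) := by
    have h1 : P * C * P = (N : ℤ) • P := by
      rw [Matrix.mul_assoc, hCP, Matrix.mul_smul, Matrix.mul_one]
    have h2 : P.det • (P * C) = P.det • ((N : ℤ) • (1 : Matrix ι ι ℤ)) := by
      have := congrArg (· * P.adjugate) h1
      simp only [Matrix.mul_assoc, Matrix.smul_mul, mul_adjugate, Matrix.mul_smul, Matrix.mul_one] at this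
      rw [this, smul_comm]
    exact smul_right_injective _ hPdet h2
  set Q : Matrix ι ι ℤ := Pᵀ * M with hQ
  -- the quadratic function vanishes on the image of `Q`
  have hq (X : ι → ℤ) : (N : ℤ) ∣ ∑ i, e i * (Q *ᵥ X) i ^ 2 := by
    obtain ⟨k, hk⟩ := heven X
    refine ⟨k, ?_⟩
    have h1 : 2 * ∑ i, e i * (Q *ᵥ X) i ^ 2 = (Q *ᵥ X) ⬝ᵥ diagonal (2 * e) *ᵥ (Q *ᵥ X) := by
      simp only [dotProduct, mulVec_diagonal, Finset.mul_sum, Pi.mul_apply, Pi.ofNat_apply]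
      exact Finset.sum_congr rfl fun i _ => by ring
    have h2 : (Q *ᵥ X) ⬝ᵥ diagonal (2 * e) *ᵥ (Q *ᵥ X) = N * (X ⬝ᵥ M *ᵥ X) := by
      rw [mulVec_mulVec, ← hC, dotProduct_comm, dotProduct_mulVec, ← mulVec_transpose, hQ, transpose_mul,
        transpose_transpose, hsym.eq, mulVec_mulVec, Matrix.mul_assoc, hPC, Matrix.mul_smul,
        Matrix.mul_one, smul_mulVec, smul_dotProduct, dotProduct_comm, smul_eq_mul]
    rw [h2, hk] at h1
    linarith
  set φ := Int.castRingHom (ZMod N)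
  have hlift (x : ι → ZMod N) : ∃ X : ι → ℤ, φ ∘ X = x :=
    ⟨fun i => (ZMod.intCast_surjective (x i)).choose,
      funext fun i => (ZMod.intCast_surjective (x i)).choose_spec⟩
  let q (a : ι → ZMod N) : ZMod N := ∑ i, (e i : ZMod N) * a i ^ 2
  have hqφ (A : ι → ℤ) : q (φ ∘ A) = φ (∑ i, e i * A i ^ 2) := by simp [q, φ]
  have hqQ (X : ι → ℤ) : q (φ ∘ (Q *ᵥ X)) = 0 := by
    rw [hqφ]
    exact (ZMod.intCast_zmod_eq_zero_iff_dvd _ _).2 (hq X)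
  refine ⟨_, ?_, sum_eq_card_of_isotropic (ZMod.isPrimitive_stdAddChar N) q (Q.map φ).mulVec
    (C.map φ)ᵀ.mulVec ?_ ?_⟩
  · exact Finset.card_pos.2 ⟨0, by simp⟩
  · intro a x
    obtain ⟨X, rfl⟩ := hlift x
    have h1 : q ((Q.map φ) *ᵥ (φ ∘ X)) = 0 := by
      rw [← hqQ X]
      congr 1
      exact (funext (RingHom.map_mulVec φ Q X)).symm
    have h2 : C.map φ = diagonal (fun i => 2 * (e i : ZMod N)) * Q.map φ := by
      rw [hC, Matrix.map_mul, diagonal_map (map_zero φ)]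
      congr 1
      simp [φ]
    rw [mulVec_transpose, ← dotProduct_mulVec, h2, ← mulVec_mulVec]
    generalize (Q.map φ) *ᵥ (φ ∘ X) = y at *
    rw [← add_zero (q a + _), ← h1]
    simp only [q, dotProduct, mulVec_diagonal, ← Finset.sum_add_distrib, Pi.add_apply]
    exact Finset.sum_congr rfl fun i _ => by ring
  · intro a ha
    obtain ⟨A, rfl⟩ := hlift a
    have h1 (i : ι) : (N : ℤ) ∣ (Cᵀ *ᵥ A) i := by
      rw [← ZMod.intCast_zmod_eq_zero_iff_dvd]
      have := congrFun ha i
      rwa [← transpose_map, ← RingHom.map_mulVec φ] at this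
    choose z hz using h1
    have h2 : A = Pᵀ *ᵥ z := by
      have h3 : Pᵀ *ᵥ (Cᵀ *ᵥ A) = (N : ℤ) • A := by
        rw [mulVec_mulVec, ← transpose_mul, hCP]
        simp
      have h4 : Cᵀ *ᵥ A = (N : ℤ) • z := funext hz
      rw [h4, mulVec_smul] at h3
      exact (smul_right_injective _ hN h3).symm
    have h5 : A = Q *ᵥ (M⁻¹ *ᵥ z) := by
      rw [hQ, mulVec_mulVec, Matrix.mul_assoc, mul_nonsing_inv _ hdet, Matrix.mul_one, h2]
    rw [h5]
    exact hqQ _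

open HurwitzZeta in
theorem hasSum_periodic_mul_exp_neg_sq {N : ℕ} [NeZero N] (f : ZMod N → ℂ) {t : ℝ} (ht : 0 < t) :
    HasSum (fun n : ℤ => f n * rexp (-π * n ^ 2 * t))
      (1 / (N * √t) * ∑ r : ZMod N,
        f r * cosKernel ((r.val / N : ℝ) : UnitAddCircle) (1 / (N ^ 2 * t))) := by
  have hN : (0 : ℝ) < N := by exact_mod_cast NeZero.pos N
  have h (r : ZMod N) : HasSum (fun n : ℤ => if (n : ZMod N) = r then f r * rexp (-π * n ^ 2 * t) else 0)
      (1 / (N * √t) * (f r * cosKernel ((r.val / N : ℝ) : UnitAddCircle) (1 / (N ^ 2 * t)))) := by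
    let g : ℤ → ℤ := fun m => m * N + r.val
    have hg : Function.Injective g := fun a b hab => by
      simpa [g, NeZero.ne N] using hab
    have hgr (m : ℤ) : (g m : ZMod N) = r := by simp [g]
    have hrange (n : ℤ) (hn : (n : ZMod N) = r) : n ∈ Set.range g := by
      have : (n : ZMod N) = ((r.val : ℤ) : ZMod N) := by simp [hn]
      obtain ⟨k, hk⟩ := (ZMod.intCast_eq_intCast_iff_dvd_sub _ _ _).1 this.symm
      exact ⟨k, by simp only [g]; linarith⟩
    rw [← hg.hasSum_iff fun n hn => if_neg fun h => hn (hrange n h)]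
    have h1 := hasSum_int_evenKernel (r.val / N : ℝ) (t := N ^ 2 * t) (by positivity)
    rw [evenKernel_functional_equation] at h1
    have h2 := (hasSum_ofReal.2 h1).mul_left (f r)
    convert! h2 using 1
    · ext m
      simp only [Function.comp, hgr, if_true]
      congr 3
      simp only [g]
      push_cast
      field_simp
    · rw [← Real.sqrt_eq_rpow, Real.sqrt_mul (by positivity), Real.sqrt_sq hN.le]
      push_cast
      ring
  rw [Finset.mul_sum]
  refine (hasSum_sum fun r _ => h r).congr_fun fun n => ?_
  simp

open HurwitzZeta in
theorem tendsto_cosKernel_atTop (a : UnitAddCircle) : Tendsto (cosKernel a) atTop (𝓝 1) := by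
  obtain ⟨p, hp, h⟩ := isBigO_atTop_cosKernel_sub a
  have h1 : Tendsto (fun x : ℝ => rexp (-p * x)) atTop (𝓝 0) :=
    Real.tendsto_exp_atBot.comp (tendsto_id.const_mul_atTop_of_neg (neg_lt_zero.2 hp))
  simpa using (h.trans_tendsto h1).add_const 1

theorem tendsto_sqrt_mul_tsum_periodic {N : ℕ} [NeZero N] (f : ZMod N → ℂ) :
    Tendsto (fun t : ℝ => √t * ∑' n : ℤ, f n * rexp (-π * n ^ 2 * t)) (𝓝[>] 0)
      (𝓝 (1 / N * ∑ r, f r)) := by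
  have hN : (0 : ℝ) < N := by exact_mod_cast NeZero.pos N
  have hinv : Tendsto (fun t : ℝ => 1 / (N ^ 2 * t)) (𝓝[>] 0) atTop := by
    have := tendsto_inv_nhdsGT_zero.const_mul_atTop (show (0 : ℝ) < 1 / N ^ 2 by positivity)
    refine this.congr fun t => by field_simp
  have h : Tendsto (fun t : ℝ => 1 / (N : ℂ) * ∑ r : ZMod N, f r *
      HurwitzZeta.cosKernel ((r.val / N : ℝ) : UnitAddCircle) (1 / (N ^ 2 * t))) (𝓝[>] 0)
      (𝓝 (1 / N * ∑ r, f r * ((1 : ℝ) : ℂ))) :=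
    (tendsto_finsetSum _ fun r _ => ((continuous_ofReal.tendsto 1).comp
      ((tendsto_cosKernel_atTop _).comp hinv)).const_mul (f r)).const_mul _
  simp only [ofReal_one, mul_one] at h
  refine h.congr' ?_
  filter_upwards [self_mem_nhdsWithin] with t ht
  rw [(hasSum_periodic_mul_exp_neg_sq f ht).tsum_eq]
  have : (√t : ℂ) ≠ 0 := by
    rw [ofReal_ne_zero]; exact (Real.sqrt_pos.2 ht).ne'
  field_simp

theorem jacobiTheta_eq_cpow_mul (τ : ℂ) :
    jacobiTheta τ = 1 / (-I * τ) ^ (1 / 2 : ℂ) * jacobiTheta (-1 / τ) := by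
  simpa [jacobiTheta_eq_jacobiTheta₂] using jacobiTheta₂_functional_equation 0 τ

theorem jacobiTheta_even_add {d : ℤ} (hd : Even d) (τ : ℂ) : jacobiTheta (d + τ) = jacobiTheta τ := by
  obtain ⟨k, rfl⟩ := hd
  have h : Function.Periodic jacobiTheta 2 := fun τ => by rw [add_comm, jacobiTheta_two_add]
  have := h.int_mul k τ
  rw [← this]
  congr 1
  push_cast; ring

theorem tendsto_jacobiTheta_comap_im_atTop : Tendsto jacobiTheta (comap im atTop) (𝓝 1) := by
  have h1 : Tendsto (fun τ : ℂ => rexp (-π * τ.im)) (comap im atTop) (𝓝 0) :=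
    Real.tendsto_exp_atBot.comp
      (tendsto_comap.const_mul_atTop_of_neg (neg_lt_zero.2 Real.pi_pos))
  simpa using (isBigO_at_im_infty_jacobiTheta_sub_one.trans_tendsto h1).add_const 1

theorem ofReal_mul_cpow_half {r : ℝ} (hr : 0 < r) {z : ℂ} (hz : z ≠ 0) :
    ((r : ℂ) * z) ^ (1 / 2 : ℂ) = √r * z ^ (1 / 2 : ℂ) := by
  have hr' : (r : ℂ) ≠ 0 := ofReal_ne_zero.2 hr.ne'
  rw [cpow_def_of_ne_zero (mul_ne_zero hr' hz), cpow_def_of_ne_zero hz, log_ofReal_mul hr hz,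
    add_mul, Complex.exp_add, Real.sqrt_eq_rpow, ofReal_cpow hr.le, cpow_def_of_ne_zero hr',
    ofReal_log hr.le]
  norm_num

theorem tendsto_sqrt_mul_jacobiTheta {d : ℤ} (hd : Even d) (hd0 : d ≠ 0) :
    Tendsto (fun t : ℝ => √t * jacobiTheta (1 / d + I * t)) (𝓝[>] 0)
      (𝓝 (1 / (-I / d) ^ (1 / 2 : ℂ) * (1 / |(d : ℝ)| : ℝ))) := by
  have hdr : (d : ℝ) ≠ 0 := by exact_mod_cast hd0
  have hdc : (d : ℂ) ≠ 0 := by exact_mod_cast hd0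
  have h0 (t : ℝ) : 1 + I * d * t ≠ 0 := by
    intro h
    simpa using congrArg re h
  have key {t : ℝ} (ht : 0 < t) : √t * jacobiTheta (1 / d + I * t) =
      1 / (-I / d * (1 + I * d * t)) ^ (1 / 2 : ℂ) *
        (1 / ((d : ℂ) ^ 2 / (1 + I * d * t)) ^ (1 / 2 : ℂ)) *
        jacobiTheta (I * (1 / (d ^ 2 * t) : ℝ) + (-1 / d : ℝ)) := by
    have htc : (t : ℂ) ≠ 0 := ofReal_ne_zero.2 ht.ne'
    have hs : (√t : ℂ) ≠ 0 := ofReal_ne_zero.2 (Real.sqrt_pos.2 ht).ne'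
    have ht0 := h0 t
    have h1 : 1 / d + I * t = (1 + I * d * t) / d := by field_simp
    have h2 : d + -1 / (1 / d + I * t) = I * (t * ((d : ℂ) ^ 2 / (1 + I * d * t))) := by
      have h5 : ∀ u : ℂ, u ≠ 0 → d + -1 / (u / d) = (u - 1) * (d / u) := fun u hu => by
        field_simp
        ring
      rw [h1, h5 _ ht0]
      ring
    have h3 : -1 / (I * (t * ((d : ℂ) ^ 2 / (1 + I * d * t)))) =
        I * (1 / (d ^ 2 * t) : ℝ) + (-1 / d : ℝ) := by
      push_cast
      field_simp
      ring_nf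
      simp only [I_sq]
      ring
    have h4 : -I * (I * (t * ((d : ℂ) ^ 2 / (1 + I * d * t)))) =
        t * ((d : ℂ) ^ 2 / (1 + I * d * t)) := by
      rw [← mul_assoc, neg_mul, I_mul_I, neg_neg, one_mul]
    rw [jacobiTheta_eq_cpow_mul, ← jacobiTheta_even_add hd, h2,
      jacobiTheta_eq_cpow_mul (I * _), h3, h4, h1,
      ofReal_mul_cpow_half ht (div_ne_zero (pow_ne_zero 2 hdc) ht0), mul_div_assoc',
      div_mul_eq_mul_div]
    field_simp
  have l0 : Tendsto (fun t : ℝ => 1 + I * d * t) (𝓝[>] 0) (𝓝 1) := by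
    have : Continuous fun t : ℝ => 1 + I * d * t := by fun_prop
    simpa using (this.tendsto 0).mono_left nhdsWithin_le_nhds
  have l1 : Tendsto (fun t : ℝ => (-I / d * (1 + I * d * t)) ^ (1 / 2 : ℂ)) (𝓝[>] 0)
      (𝓝 ((-I / d) ^ (1 / 2 : ℂ))) := by
    refine Tendsto.cpow (by simpa using l0.const_mul (-I / (d : ℂ))) tendsto_const_nhds ?_
    right
    rw [← ofReal_intCast, div_ofReal_im]
    simpa using hd0
  have l2 : Tendsto (fun t : ℝ => ((d : ℂ) ^ 2 / (1 + I * d * t)) ^ (1 / 2 : ℂ)) (𝓝[>] 0)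
      (𝓝 ((|(d : ℝ)| : ℝ) : ℂ)) := by
    have h1 : ((|(d : ℝ)| : ℝ) : ℂ) = ((d : ℂ) ^ 2 / 1) ^ (1 / 2 : ℂ) := by
      have := ofReal_mul_cpow_half (r := (d : ℝ) ^ 2) (by positivity) one_ne_zero
      rw [one_cpow, Real.sqrt_sq_eq_abs] at this
      simpa using this.symm
    rw [h1]
    refine Tendsto.cpow (tendsto_const_nhds.div l0 one_ne_zero) tendsto_const_nhds ?_
    left
    rw [div_one, ← ofReal_intCast, ← ofReal_pow, ofReal_re]
    positivity
  have l3 : Tendsto (fun t : ℝ => jacobiTheta (I * (1 / (d ^ 2 * t) : ℝ) + (-1 / d : ℝ))) (𝓝[>] 0)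
      (𝓝 1) := by
    refine tendsto_jacobiTheta_comap_im_atTop.comp (tendsto_comap_iff.2 ?_)
    have := tendsto_inv_nhdsGT_zero.const_mul_atTop (show (0 : ℝ) < 1 / d ^ 2 by positivity)
    refine this.congr fun t => ?_
    rw [Function.comp, add_im, ofReal_im, im_mul_ofReal, I_im]
    field_simp
    ring
  have h1 : (-I / d) ^ (1 / 2 : ℂ) ≠ 0 := by simp [cpow_eq_zero_iff, hd0]
  have h2 : ((|(d : ℝ)| : ℝ) : ℂ) ≠ 0 := ofReal_ne_zero.2 (abs_ne_zero.2 hdr)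
  have := (((tendsto_const_nhds (x := (1 : ℂ))).div l1 h1).mul ((tendsto_const_nhds (x := (1 : ℂ))).div l2 h2)).mul l3
  rw [mul_one] at this
  rw [ofReal_div, ofReal_one]
  refine this.congr' ?_
  filter_upwards [self_mem_nhdsWithin] with t ht
  exact (key ht).symm

theorem exists_sum_stdAddChar_mul_sq_eq {N : ℕ} [NeZero N] {d e : ℤ} (hd : Even d)
    (h : 2 * e * d = N) :
    ∃ c : ℝ, 0 < c ∧
      ∑ y : ZMod N, ZMod.stdAddChar ((e : ZMod N) * y ^ 2) = c * cexp (π * I / 4 * d.sign) := by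
  have hN : (N : ℂ) ≠ 0 := by exact_mod_cast NeZero.ne N
  have hd0 : d ≠ 0 := by
    rintro rfl
    simp [eq_comm, NeZero.ne N] at h
  have hdr : (d : ℝ) ≠ 0 := by exact_mod_cast hd0
  have hdc : (d : ℂ) ≠ 0 := by exact_mod_cast hd0
  have hc : 2 * (e : ℂ) * d = N := by exact_mod_cast h
  have l1 := tendsto_sqrt_mul_tsum_periodic fun y : ZMod N => (ZMod.stdAddChar ((e : ZMod N) * y ^ 2) : ℂ)
  have l2 := tendsto_sqrt_mul_jacobiTheta hd hd0
  have hlim := tendsto_nhds_unique (l1.congr fun t => ?_) l2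
  swap
  · congr 1
    rw [jacobiTheta]
    refine tsum_congr fun n => ?_
    have h1 : (e : ZMod N) * (n : ZMod N) ^ 2 = ((e * n ^ 2 : ℤ) : ZMod N) := by push_cast; ring
    rw [h1, ZMod.stdAddChar_coe, ofReal_exp, ← Complex.exp_add, ← hc]
    have he : (e : ℂ) ≠ 0 := by rintro h0; simp [h0] at hc; exact hN hc.symm
    congr 1
    push_cast
    field_simp
    ring_nf
    simp only [I_sq]
    ring
  have hcpow : 1 / (-I / d : ℂ) ^ (1 / 2 : ℂ) = √|(d : ℝ)| * cexp (π * I / 4 * d.sign) := by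
    have hpos : (0 : ℝ) < |(d : ℝ)|⁻¹ := by positivity
    rcases hd0.lt_or_gt with hlt | hgt
    · have h1 : (-I / d : ℂ) = (|(d : ℝ)|⁻¹ : ℝ) * I := by
        rw [abs_of_neg (by exact_mod_cast hlt)]
        push_cast
        field_simp
      rw [h1, ofReal_mul_cpow_half hpos I_ne_zero, cpow_def_of_ne_zero I_ne_zero, log_I,
        Int.sign_eq_neg_one_of_neg hlt, Real.sqrt_inv, ofReal_inv, one_div, mul_inv, inv_inv,
        ← Complex.exp_neg]
      congr 2
      push_cast
      ring
    · have h1 : (-I / d : ℂ) = (|(d : ℝ)|⁻¹ : ℝ) * (-I) := by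
        rw [abs_of_pos (by exact_mod_cast hgt)]
        push_cast
        field_simp
      rw [h1, ofReal_mul_cpow_half hpos (neg_ne_zero.2 I_ne_zero),
        cpow_def_of_ne_zero (neg_ne_zero.2 I_ne_zero), log_neg_I,
        Int.sign_eq_one_of_pos hgt, Real.sqrt_inv, ofReal_inv, one_div, mul_inv, inv_inv,
        ← Complex.exp_neg]
      congr 2
      push_cast
      ring
  refine ⟨N * (√|(d : ℝ)| * (1 / |(d : ℝ)|)), ?_, ?_⟩
  · have := NeZero.pos N
    positivity
  · rw [hcpow, one_div, inv_mul_eq_iff_eq_mul₀ hN] at hlim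
    rw [hlim]
    push_cast
    ring

theorem Matrix.IsSymm.even_dotProduct_mulVec {ι : Type*} [Fintype ι]
    {M : Matrix ι ι ℤ} (hM : M.IsSymm) (heven : ∀ i, Even (M i i)) (x : ι → ℤ) :
    Even (x ⬝ᵥ M *ᵥ x) := by
  classical
  rw [← ZMod.intCast_eq_zero_iff_even]
  simp only [dotProduct, mulVec, Finset.mul_sum, Int.cast_sum]
  rw [← Finset.sum_product', Finset.univ_product_univ]
  refine Finset.sum_involution (fun p _ => p.swap) (fun p _ => ?_) (fun p _ hp => ?_)
    (fun _ _ => Finset.mem_univ _) (fun p _ => Prod.swap_swap p)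
  · have h : x p.2 * (M p.2 p.1 * x p.1) = x p.1 * (M p.1 p.2 * x p.2) := by
      rw [hM.apply]; ring
    simp only [Prod.fst_swap, Prod.snd_swap, h]
    exact CharTwo.add_self_eq_zero _
  · contrapose! hp
    obtain ⟨i, j⟩ := p
    obtain rfl : j = i := congrArg Prod.fst hp
    rw [ZMod.intCast_eq_zero_iff_even]
    exact ((heven _).mul_right _).mul_left _

theorem sum_sign_eq_card_sub_card {ι : Type*} [Fintype ι] (d : ι → ℤ) :
    ∑ i, (d i).sign = ((Finset.univ.filter fun i => 0 < d i).card : ℤ) -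
      ((Finset.univ.filter fun i => d i < 0).card : ℤ) := by
  rw [Finset.card_filter, Finset.card_filter, Nat.cast_sum, Nat.cast_sum, ← Finset.sum_sub_distrib]
  refine Finset.sum_congr rfl fun i _ => ?_
  rcases lt_trichotomy (d i) 0 with h | h | h
  · simp [h, Int.sign_eq_neg_one_of_neg h, h.not_gt]
  · simp [h]
  · simp [h, Int.sign_eq_one_of_pos h, h.not_gt]

theorem eight_dvd_of_mul_exp_eq {s : ℤ} {c k : ℝ} (hc : 0 < c) (hk : 0 < k)
    (h : c * cexp (π * I / 4 * s) = k) : (8 : ℤ) ∣ s := by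
  have hnorm : ‖cexp (π * I / 4 * s)‖ = 1 := by
    rw [show (π * I / 4 * s : ℂ) = (π / 4 * s : ℝ) * I by push_cast; ring, norm_exp_ofReal_mul_I]
  have hck : c = k := by
    have := congrArg norm h
    rwa [norm_mul, hnorm, mul_one, norm_real, norm_real, Real.norm_of_nonneg hc.le,
      Real.norm_of_nonneg hk.le] at this
  rw [← hck, mul_eq_left₀ (ofReal_ne_zero.2 hc.ne'), Complex.exp_eq_one_iff] at h
  obtain ⟨m, hm⟩ := h
  refine ⟨m, ?_⟩
  have hπ : (π * I : ℂ) ≠ 0 := mul_ne_zero (ofReal_ne_zero.2 Real.pi_ne_zero) I_ne_zero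
  have : (s : ℂ) = 8 * m := mul_left_cancel₀ hπ (by linear_combination 4 * hm)
  exact_mod_cast this

theorem eight_dvd_sum_sign {ι : Type*} [Fintype ι] [DecidableEq ι] {M P : Matrix ι ι ℤ}
    {d : ι → ℤ} (hsym : M.IsSymm) (hdet : IsUnit M.det) (heven : ∀ i, Even (M i i))
    (hPdet : P.det ≠ 0) (hP : Pᵀ * M * P = diagonal d) : (8 : ℤ) ∣ ∑ i, (d i).sign := by
  have hM := hsym.even_dotProduct_mulVec heven
  have hd0 : ∏ i, d i ≠ 0 := by
    rw [← det_diagonal, ← hP, det_mul, det_mul, det_transpose]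
    exact mul_ne_zero (mul_ne_zero hPdet hdet.ne_zero) hPdet
  have hd (i : ι) : Even (d i) := by
    have h : d i = P.col i ⬝ᵥ M *ᵥ P.col i := by
      rw [← diagonal_apply_eq d i, ← hP, Matrix.mul_assoc]
      rfl
    exact h ▸ hM _
  let N : ℕ := 2 * (∏ i, d i).natAbs
  have : NeZero N := ⟨mul_ne_zero two_ne_zero (Int.natAbs_ne_zero.2 hd0)⟩
  have he (i : ι) : ∃ e : ℤ, 2 * e * d i = N := by
    obtain ⟨e, he⟩ := Int.dvd_natAbs.2 (Finset.dvd_prod_of_mem d (Finset.mem_univ i))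
    exact ⟨e, by simp only [N]; push_cast at he ⊢; linarith⟩
  choose e he using he
  obtain ⟨k, hk, hsum⟩ := exists_sum_stdAddChar_eq_natCast hsym hdet hM hP he
  choose c hc hgauss using fun i => exists_sum_stdAddChar_mul_sq_eq (hd i) (he i)
  refine eight_dvd_of_mul_exp_eq (c := ∏ i, c i) (k := k) (Finset.prod_pos fun i _ => hc i)
    (by exact_mod_cast hk) ?_
  rw [ofReal_natCast, ← hsum]
  have hfactor (a : ι → ZMod N) : ZMod.stdAddChar (∑ i, (e i : ZMod N) * a i ^ 2) =
      ∏ i, ZMod.stdAddChar ((e i : ZMod N) * a i ^ 2) :=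
    AddChar.map_finset_sum _ _
  simp_rw [hfactor]
  rw [← Fintype.piFinset_univ, ← Finset.prod_univ_sum (fun _ => Finset.univ)
    fun i y => ZMod.stdAddChar ((e i : ZMod N) * y ^ 2)]
  simp_rw [hgauss]
  rw [Finset.prod_mul_distrib, ← Complex.exp_sum, ← Finset.mul_sum]
  push_cast
  rfl

/-- An even unimodular symmetric bilinear form over ℤ has signature divisible by 8,
where the signature is the number of positive eigenvalues minus the number of negative
eigenvalues of the associated real symmetric matrix. -/
theorem signature_of_even_unimodular_form_dvd_eight
    {n : ℕ} (M : Matrix (Fin n) (Fin n) ℤ) (hsym : M.IsSymm)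
    (hdet : M.det = 1 ∨ M.det = -1)
    (heven : ∀ i, Even (M i i))
    (hH : (M.map (Int.cast : ℤ → ℝ)).IsHermitian) :
    (8 : ℤ) ∣
      ((Finset.univ.filter fun i => 0 < hH.eigenvalues i).card : ℤ) -
        ((Finset.univ.filter fun i => hH.eigenvalues i < 0).card : ℤ) := by
  obtain ⟨P, d, hPdet, hP⟩ := hsym.exists_int_transpose_mul_mul_eq_diagonal
  have hPreal : IsUnit (P.map (Int.cast : ℤ → ℝ)).det := by
    have h : (P.map (Int.cast : ℤ → ℝ)).det = P.det := ((Int.castRingHom ℝ).map_det P).symm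
    rw [h, isUnit_iff_ne_zero]
    exact_mod_cast hPdet
  have hdiag : (P.map (Int.cast : ℤ → ℝ))ᵀ * M.map (Int.cast : ℤ → ℝ) * P.map (Int.cast : ℤ → ℝ) =
      Matrix.diagonal fun i => (d i : ℝ) := by
    rw [← Matrix.map_intCast_transpose_mul_mul, hP, Matrix.diagonal_map Int.cast_zero]
  obtain ⟨hpos, hneg⟩ := hH.card_eigenvalues_of_diagonal hPreal hdiag
  have h := eight_dvd_sum_sign hsym (Int.isUnit_iff.2 hdet) heven hPdet hP
  rw [sum_sign_eq_card_sub_card] at h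
  simpa only [hpos, hneg, Int.cast_pos, Int.cast_lt_zero] using h
end

section
/- The explicit 8 × 8 integer matrix E8 with rows (2,1,0,0,0,0,0,0), (1,2,1,0,0,0,0,0), (0,1,2,1,0,0,0,0), (0,0,1,2,1,0,0,0), (0,0,0,1,2,1,0,1), (0,0,0,0,1,2,1,0), (0,0,0,0,0,1,2,0), (0,0,0,0,1,0,0,2) is symmetric, has determinant 1, is even (the integer xᵀ E8 x is even for every integer vector x), and is positive definite (xᵀ E8 x > 0 for every nonzero real vector x, where E8 is viewed as a real matrix via Int.cast). -/
open Matrix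
/-- The E8 matrix. -/
def E8 : Matrix (Fin 8) (Fin 8) ℤ :=
  ![![2, 1, 0, 0, 0, 0, 0, 0],
    ![1, 2, 1, 0, 0, 0, 0, 0],
    ![0, 1, 2, 1, 0, 0, 0, 0],
    ![0, 0, 1, 2, 1, 0, 0, 0],
    ![0, 0, 0, 1, 2, 1, 0, 1],
    ![0, 0, 0, 0, 1, 2, 1, 0],
    ![0, 0, 0, 0, 0, 1, 2, 0],
    ![0, 0, 0, 0, 1, 0, 0, 2]]

/-- The quadratic form of `E8` over any commutative ring. -/
lemma E8_dotProduct_mulVec {R : Type*} [CommRing R] (x : Fin 8 → R) :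
    x ⬝ᵥ (E8.map (Int.cast : ℤ → R)).mulVec x =
      2 * (x 0 ^ 2 + x 1 ^ 2 + x 2 ^ 2 + x 3 ^ 2 + x 4 ^ 2 + x 5 ^ 2 + x 6 ^ 2 + x 7 ^ 2 +
        x 0 * x 1 + x 1 * x 2 + x 2 * x 3 + x 3 * x 4 + x 4 * x 5 + x 5 * x 6 + x 4 * x 7) := by
  simp only [dotProduct, mulVec, map_apply, Fin.sum_univ_eight]
  simp [E8]
  ring

lemma E8_isSymm : E8.IsSymm := by
  unfold Matrix.IsSymm
  decide

/-- An upper triangular matrix that brings `E8` to lower triangular form by right multiplication. -/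
def E8Reduction : Matrix (Fin 8) (Fin 8) ℤ :=
  ![![1, -1, 1, -1, 1, -1, 1, -3],
    ![0, 2, -2, 2, -2, 2, -2, 6],
    ![0, 0, 3, -3, 3, -3, 3, -9],
    ![0, 0, 0, 4, -4, 4, -4, 12],
    ![0, 0, 0, 0, 5, -5, 5, -15],
    ![0, 0, 0, 0, 0, 6, -6, 10],
    ![0, 0, 0, 0, 0, 0, 7, -5],
    ![0, 0, 0, 0, 0, 0, 0, 8]]

lemma E8_det : E8.det = 1 := by
  have hU : E8Reduction.IsUpperTriangular := fun i j ↦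
    (by decide : ∀ j i, j < i → E8Reduction i j = 0) j i
  have hL : (E8 * E8Reduction).IsLowerTriangular := fun i j ↦
    (by decide : ∀ i j, i < j → (E8 * E8Reduction) i j = 0) i j
  have hU_det : E8Reduction.det = 40320 := (det_of_isUpperTriangular hU).trans (by decide)
  have hL_det : (E8 * E8Reduction).det = 40320 :=
    (det_of_isLowerTriangular _ hL).trans (by decide)
  rw [det_mul, hU_det] at hL_det
  lia

lemma E8_even (x : Fin 8 → ℤ) : Even (x ⬝ᵥ E8.mulVec x) := by
  have h := E8_dotProduct_mulVec x
  rw [show E8.map (Int.cast : ℤ → ℤ) = E8 by ext; simp] at h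
  exact h ▸ even_two_mul _

lemma E8_posDef : (E8.map (Int.cast : ℤ → ℝ)).PosDef := by
  refine posDef_iff_dotProduct_mulVec.2 ⟨?_, fun x hx ↦ ?_⟩
  · rw [IsHermitian, conjTranspose_eq_transpose_of_trivial, ← transpose_map, E8_isSymm.eq]
  rw [star_trivial, E8_dotProduct_mulVec]
  by_contra! hle
  have h4 : x 4 = 0 := by
    rw [← sq_eq_zero_iff]
    nlinarith [sq_nonneg (2 * x 0 + x 1), sq_nonneg (3 * x 1 + 2 * x 2),
      sq_nonneg (4 * x 2 + 3 * x 3), sq_nonneg (5 * x 3 + 4 * x 4), sq_nonneg (2 * x 6 + x 5),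
      sq_nonneg (3 * x 5 + 2 * x 4), sq_nonneg (2 * x 7 + x 4), sq_nonneg (x 4)]
  simp only [h4] at hle
  have h3 : x 3 = 0 := by
    rw [← sq_eq_zero_iff]
    nlinarith [sq_nonneg (2 * x 0 + x 1), sq_nonneg (3 * x 1 + 2 * x 2),
      sq_nonneg (4 * x 2 + 3 * x 3), sq_nonneg (2 * x 6 + x 5), sq_nonneg (x 3),
      sq_nonneg (x 5), sq_nonneg (x 7)]
  simp only [h3] at hle
  have h2 : x 2 = 0 := by
    rw [← sq_eq_zero_iff]
    nlinarith [sq_nonneg (2 * x 0 + x 1), sq_nonneg (3 * x 1 + 2 * x 2),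
      sq_nonneg (2 * x 6 + x 5), sq_nonneg (x 2), sq_nonneg (x 5), sq_nonneg (x 7)]
  simp only [h2] at hle
  have h5 : x 5 = 0 := by
    rw [← sq_eq_zero_iff]
    nlinarith [sq_nonneg (2 * x 0 + x 1), sq_nonneg (2 * x 6 + x 5), sq_nonneg (x 1),
      sq_nonneg (x 5), sq_nonneg (x 7)]
  have h1 : x 1 = 0 := by
    rw [← sq_eq_zero_iff]
    nlinarith [sq_nonneg (2 * x 0 + x 1), sq_nonneg (2 * x 6 + x 5), sq_nonneg (x 1),
      sq_nonneg (x 5), sq_nonneg (x 7)]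
  simp only [h5, h1] at hle
  have h0 : x 0 = 0 := by nlinarith
  have h6 : x 6 = 0 := by nlinarith
  have h7 : x 7 = 0 := by nlinarith
  exact hx (by ext i; fin_cases i <;> assumption)

/-- The E8 matrix is symmetric, unimodular (determinant 1), even, and positive definite. -/
theorem E8_symm_unimodular_even_posDef :
    E8.IsSymm ∧ E8.det = 1 ∧ (∀ x : Fin 8 → ℤ, Even (x ⬝ᵥ E8.mulVec x)) ∧
      (E8.map (Int.cast : ℤ → ℝ)).PosDef := by
  exact ⟨E8_isSymm, E8_det, E8_even, E8_posDef⟩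
end

section
/- If M is an n × n symmetric integer matrix that is unimodular (det M = ±1), even (every diagonal entry M i i is even), and positive definite (xᵀ M x > 0 for every nonzero real vector x, viewing M as a real matrix), then n is divisible by 8. In particular, there is no positive definite even unimodular symmetric bilinear form on ℤⁿ for 0 < n < 8. -/
open Complex Filter Topology Matrix
open scoped ComplexOrder

/-- A family of series dominated by a Gaussian of parameter `T i → ∞` tends to its constant term. -/
lemma tendsto_tsum_int_of_norm_le_gaussian {ι : Type*} {l : Filter ι} {T : ι → ℝ}
    (hT : Tendsto T l atTop) {f : ι → ℤ → ℂ} (hf0 : ∀ i, f i 0 = 1)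
    (hf : ∀ᶠ i in l, ∀ n, ‖f i n‖ ≤ Real.exp (-Real.pi * T i * n ^ 2)) :
    Tendsto (fun i ↦ ∑' n, f i n) l (𝓝 1) := by
  have hsum : Summable fun n : ℤ ↦ Real.exp (-Real.pi * 1 * n ^ 2) := by
    have h := (summable_jacobiTheta₂_term_iff 0 I).2 (by simp)
    refine h.norm.congr fun n ↦ ?_
    rw [norm_jacobiTheta₂_term]
    simp
  have h := tendsto_tsum_of_dominated_convergence (𝓕 := l) (f := f)
    (g := fun n : ℤ ↦ if n = 0 then 1 else 0) hsum (fun n ↦ ?_) ?_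
  · simpa using h
  · rcases eq_or_ne n 0 with rfl | hn
    · simpa [hf0] using tendsto_const_nhds
    · simp only [hn, if_false]
      refine squeeze_zero_norm' (hf.mono fun i hi ↦ hi n) ?_
      refine Real.tendsto_exp_atBot.comp ?_
      have : (0 : ℝ) < Real.pi * n ^ 2 := by positivity
      refine (tendsto_neg_atTop_atBot.comp (hT.const_mul_atTop this)).congr fun i ↦ ?_
      simp only [Function.comp_apply]
      ring
  · filter_upwards [hf, hT.eventually_ge_atTop 1] with i hi h1 n
    refine (hi n).trans (Real.exp_le_exp.2 ?_)
    have : 0 ≤ Real.pi * n ^ 2 := by positivity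
    nlinarith

/-- Decomposition of a sum over the integers into residue classes. -/
lemma tsum_int_eq_sum_residues {N : ℕ} [NeZero N] {f : ℤ → ℂ} (hf : Summable f) :
    ∑' n, f n = ∑ k ∈ Finset.range N, ∑' m : ℤ, f (m * N + k) := by
  rw [← (Int.divModEquiv N).symm.tsum_eq f]
  have hs : Summable fun p : ℤ × Fin N ↦ f ((Int.divModEquiv N).symm p) :=
    (Int.divModEquiv N).symm.summable_iff.2 hf
  rw [← (Equiv.prodComm _ _).tsum_eq]
  simp only [Equiv.prodComm_apply, Prod.swap]
  rw [Summable.tsum_prod (f := fun p : Fin N × ℤ ↦ f ((Int.divModEquiv N).symm (p.2, p.1)))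
      ((Equiv.prodComm _ _).summable_iff.2 hs), tsum_fintype,
    ← Fin.sum_univ_eq_sum_range (fun k ↦ ∑' m : ℤ, f (m * N + k))]
  rfl

lemma summable_cexp_neg_mul_int_sq {a : ℂ} (ha : 0 < a.re) :
    Summable fun n : ℤ ↦ cexp (-Real.pi * a * n ^ 2) := by
  have h := (summable_jacobiTheta₂_term_iff 0 (I * a)).2 (by simpa using ha)
  refine h.congr fun n ↦ ?_
  rw [jacobiTheta₂_term]
  congr 1
  linear_combination (Real.pi * a * n ^ 2 : ℂ) * I_sq

/-- Small-parameter asymptotics of a Gaussian summed over an arithmetic progression. -/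
lemma tendsto_sqrt_mul_tsum_gaussian_residue {N : ℕ} (hN : 0 < N) (k : ℕ) :
    Tendsto (fun ε : ℝ ↦ (√ε : ℂ) * ∑' m : ℤ, cexp (-Real.pi * ε * (m * N + k) ^ 2))
      (𝓝[>] 0) (𝓝 (1 / N)) := by
  have hN' : (0 : ℝ) < N := by exact_mod_cast hN
  have key : ∀ᶠ ε : ℝ in 𝓝[>] 0, (1 / N : ℂ) * ∑' n : ℤ,
      cexp (-Real.pi * (n ^ 2 / (N ^ 2 * ε)) + 2 * Real.pi * I * n * k / N) =
      (√ε : ℂ) * ∑' m : ℤ, cexp (-Real.pi * ε * (m * N + k) ^ 2) := by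
    filter_upwards [self_mem_nhdsWithin] with ε hε
    have hε : 0 < ε := hε
    have h := Complex.tsum_exp_neg_quadratic (a := ((N ^ 2 * ε : ℝ) : ℂ))
      (by rw [ofReal_re]; positivity) (-(N * k * ε))
    have h1 : (((N ^ 2 * ε : ℝ) : ℂ)) ^ (1 / 2 : ℂ) = N * √ε := by
      rw [show (1 / 2 : ℂ) = ((1 / 2 : ℝ) : ℂ) by norm_num, ← ofReal_cpow (by positivity),
        ← Real.sqrt_eq_rpow, Real.sqrt_mul (by positivity), Real.sqrt_sq hN'.le]
      push_cast; rfl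
    have h2 : ∀ m : ℤ, cexp (-Real.pi * ε * (m * N + k) ^ 2) = cexp (-Real.pi * ε * k ^ 2) *
        cexp (-Real.pi * ((N ^ 2 * ε : ℝ) : ℂ) * m ^ 2 + 2 * Real.pi * (-(N * k * ε)) * m) := by
      intro m
      rw [← Complex.exp_add]
      congr 1
      push_cast
      ring
    have h3 : ∀ n : ℤ, cexp (-Real.pi / ((N ^ 2 * ε : ℝ) : ℂ) * (n + I * (-(N * k * ε))) ^ 2) =
        cexp (Real.pi * ε * k ^ 2) *
          cexp (-Real.pi * (n ^ 2 / (N ^ 2 * ε)) + 2 * Real.pi * I * n * k / N) := by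
      intro n
      rw [← Complex.exp_add]
      congr 1
      push_cast
      field_simp
      ring_nf
      simp only [I_sq]
      ring
    simp_rw [h2, tsum_mul_left, h, h1, h3, tsum_mul_left]
    have h4 : cexp (-Real.pi * ε * k ^ 2) * cexp (Real.pi * ε * k ^ 2) = 1 := by
      rw [← Complex.exp_add]; simp
    generalize (∑' n : ℤ,
      cexp (-Real.pi * (n ^ 2 / (N ^ 2 * ε)) + 2 * Real.pi * I * n * k / N)) = S
    calc (1 / N : ℂ) * S = (cexp (-Real.pi * ε * k ^ 2) * cexp (Real.pi * ε * k ^ 2)) *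
          (1 / N) * S := by rw [h4, one_mul]
      _ = _ := by field_simp
  refine Tendsto.congr' key ?_
  conv => enter [3, 1]; rw [← mul_one (1 / N : ℂ)]
  refine Tendsto.const_mul _ (tendsto_tsum_int_of_norm_le_gaussian
    (T := fun ε : ℝ ↦ (1 / N ^ 2) * ε⁻¹)
    (tendsto_inv_nhdsGT_zero.const_mul_atTop (by positivity)) (by simp) ?_)
  refine Eventually.of_forall fun ε n ↦ ?_
  rw [Complex.norm_exp]
  refine Real.exp_le_exp.2 (le_of_eq ?_)
  have : (-Real.pi * (n ^ 2 / (N ^ 2 * ε)) + 2 * Real.pi * I * n * k / N : ℂ) =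
    ((-Real.pi * (1 / N ^ 2 * ε⁻¹) * n ^ 2 : ℝ) : ℂ) + ((2 * Real.pi * n * k / N : ℝ) : ℂ) * I := by
    push_cast; ring
  rw [this, add_re, ofReal_re, re_ofReal_mul, I_re, mul_zero, add_zero]

/-- Behaviour of the theta series near the cusp `1 / d`, from two applications of its functional
equation. -/
lemma tendsto_sqrt_mul_tsum_cexp_near_rational {d : ℕ} (hd : 0 < d) (hd2 : Even d) :
    Tendsto (fun ε : ℝ ↦ (√ε : ℂ) * ∑' n : ℤ, cexp (-Real.pi * (ε - I / d) * n ^ 2))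
      (𝓝[>] 0) (𝓝 (cexp (Real.pi * I / 4) / √d)) := by
  have hd' : (0 : ℝ) < d := by exact_mod_cast hd
  have hdC : (d : ℂ) ≠ 0 := by exact_mod_cast hd.ne'
  have key : ∀ᶠ ε : ℝ in 𝓝[>] 0, (1 / (ε - I / d : ℂ) ^ (1 / 2 : ℂ)) *
      (1 / (d ^ 2 / (1 + I * d * ε) : ℂ) ^ (1 / 2 : ℂ)) *
        ∑' n : ℤ, cexp (-Real.pi * (1 / (d ^ 2 * ε) + I / d) * n ^ 2) =
      (√ε : ℂ) * ∑' n : ℤ, cexp (-Real.pi * (ε - I / d) * n ^ 2) := by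
    filter_upwards [self_mem_nhdsWithin] with ε hε
    have hε : 0 < ε := hε
    have hεC : (ε : ℂ) ≠ 0 := by exact_mod_cast hε.ne'
    have hw : (1 + I * d * ε : ℂ) ≠ 0 := by
      intro h; simpa using congrArg re h
    have hw' : (ε - I / d : ℂ) ≠ 0 := by
      intro h; have := congrArg re h
      simp [div_natCast_re] at this
      exact hε.ne' this
    have hδ : ((ε : ℂ) * (d ^ 2 / (1 + I * d * ε))) = 1 / (1 / (d ^ 2 * ε) + I / d) := by
      field_simp
    have hδre : 0 < ((ε : ℂ) * (d ^ 2 / (1 + I * d * ε))).re := by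
      rw [re_ofReal_mul]
      refine mul_pos hε ?_
      rw [show ((d : ℂ) ^ 2 / (1 + I * d * ε)) = ((d ^ 2 : ℝ) : ℂ) * (1 + I * d * ε)⁻¹ by
        push_cast; rfl, re_ofReal_mul, inv_re]
      refine mul_pos (by positivity) (div_pos (by simp) (normSq_pos.2 hw))
    have h1 := Complex.tsum_exp_neg_mul_int_sq (a := (ε - I / d : ℂ))
      (by simpa [div_natCast_re] using hε)
    have h2 := Complex.tsum_exp_neg_mul_int_sq hδre
    have h3 : ∀ n : ℤ, cexp (-Real.pi / (ε - I / d : ℂ) * n ^ 2) =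
        cexp (-Real.pi * ((ε : ℂ) * (d ^ 2 / (1 + I * d * ε))) * n ^ 2) := by
      intro n
      obtain ⟨a, ha⟩ := hd2
      rw [Complex.exp_eq_exp_iff_exists_int]
      refine ⟨-(a * n ^ 2), ?_⟩
      have hw2 : (ε * d - I : ℂ) ≠ 0 := by
        intro h; apply hw'; field_simp; rw [h, mul_zero]
      have ha' : (a : ℂ) = d / 2 := by rw [ha]; push_cast; ring
      have e : (1 / (ε - I / d) : ℂ) = ε * (d ^ 2 / (1 + I * d * ε)) + I * d := by
        have : (ε - I / d : ℂ) = -I * (1 + I * d * ε) / d := by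
          field_simp
          linear_combination (ε * d : ℂ) * I_sq
        rw [this]
        field_simp
        linear_combination (-I * ε * d - 1 : ℂ) * I_sq
      push_cast
      rw [ha', div_eq_mul_one_div, e]
      ring
    have hv : (d ^ 2 / (1 + I * d * ε) : ℂ) ≠ 0 := div_ne_zero (pow_ne_zero 2 hdC) hw
    have h4 : (ε * (d ^ 2 / (1 + I * d * ε)) : ℂ) ^ (1 / 2 : ℂ) =
        √ε * (d ^ 2 / (1 + I * d * ε) : ℂ) ^ (1 / 2 : ℂ) := by
      rw [cpow_def_of_ne_zero (mul_ne_zero hεC hv), cpow_def_of_ne_zero hv,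
        log_ofReal_mul hε hv, add_mul, Complex.exp_add, ← ofReal_one, ← ofReal_ofNat, ← ofReal_div,
        ← ofReal_mul, ← ofReal_exp, Real.sqrt_eq_rpow, Real.rpow_def_of_pos hε]
    have h6 : ∀ n : ℤ, cexp (-Real.pi / ((ε : ℂ) * (d ^ 2 / (1 + I * d * ε))) * n ^ 2) =
        cexp (-Real.pi * (1 / (d ^ 2 * ε) + I / d) * n ^ 2) := by
      intro n
      rw [hδ]; simp
    rw [h1]
    simp_rw [h3]
    rw [h2, h4]
    simp_rw [h6]
    field_simp
  refine Tendsto.congr' key ?_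
  have hlim1 : Tendsto (fun ε : ℝ ↦ 1 / (ε - I / d : ℂ) ^ (1 / 2 : ℂ)) (𝓝[>] 0)
      (𝓝 (1 / (((0 : ℝ) : ℂ) - I / d : ℂ) ^ (1 / 2 : ℂ))) := by
    refine (ContinuousAt.tendsto (f := fun ε : ℝ ↦ 1 / (ε - I / d : ℂ) ^ (1 / 2 : ℂ)) ?_).mono_left
      nhdsWithin_le_nhds
    refine continuousAt_const.div (ContinuousAt.cpow (by fun_prop) continuousAt_const ?_) ?_
    · refine Or.inr ?_
      simp [div_natCast_im, hd.ne']
    · simp [cpow_eq_zero_iff, hd.ne']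
  have hlim2 : Tendsto (fun ε : ℝ ↦ 1 / (d ^ 2 / (1 + I * d * ε) : ℂ) ^ (1 / 2 : ℂ)) (𝓝[>] 0)
      (𝓝 (1 / (d ^ 2 / (1 + I * d * (0 : ℝ)) : ℂ) ^ (1 / 2 : ℂ))) := by
    refine (ContinuousAt.tendsto
      (f := fun ε : ℝ ↦ 1 / (d ^ 2 / (1 + I * d * ε) : ℂ) ^ (1 / 2 : ℂ)) ?_).mono_left
      nhdsWithin_le_nhds
    refine continuousAt_const.div (ContinuousAt.cpow
      (continuousAt_const.div (by fun_prop) (by simp)) continuousAt_const ?_) ?_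
    · refine Or.inl ?_
      simp only [ofReal_zero, mul_zero, add_zero, div_one]
      exact_mod_cast pow_pos hd 2
    · simp [cpow_eq_zero_iff, hd.ne']
  have hlim3 : Tendsto (fun ε : ℝ ↦ ∑' n : ℤ, cexp (-Real.pi * (1 / (d ^ 2 * ε) + I / d) * n ^ 2))
      (𝓝[>] 0) (𝓝 1) := by
    refine tendsto_tsum_int_of_norm_le_gaussian (T := fun ε : ℝ ↦ (1 / d ^ 2) * ε⁻¹)
      (tendsto_inv_nhdsGT_zero.const_mul_atTop (by positivity)) (by simp) ?_
    refine Eventually.of_forall fun ε n ↦ ?_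
    rw [Complex.norm_exp]
    refine Real.exp_le_exp.2 (le_of_eq ?_)
    have : (-Real.pi * (1 / (d ^ 2 * ε) + I / d) * n ^ 2 : ℂ) =
      ((-Real.pi * (1 / d ^ 2 * ε⁻¹) * n ^ 2 : ℝ) : ℂ) + ((-Real.pi * n ^ 2 / d : ℝ) : ℂ) * I := by
      push_cast; ring
    rw [this, add_re, ofReal_re, re_ofReal_mul, I_re, mul_zero, add_zero]
  convert (hlim1.mul hlim2).mul hlim3 using 2
  have e1 : (((0 : ℝ) : ℂ) - I / d) ^ (1 / 2 : ℂ) = cexp (-(Real.pi * I / 4)) / √d := by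
    have : (((0 : ℝ) : ℂ) - I / d) = (((d : ℝ)⁻¹ : ℝ) : ℂ) * (-I) := by push_cast; ring
    rw [this, cpow_def_of_ne_zero (by simp [hd.ne']), log_ofReal_mul (by positivity) (by simp),
      log_neg_I, add_mul, Complex.exp_add, ← ofReal_one, ← ofReal_ofNat, ← ofReal_div,
        ← ofReal_mul, ← ofReal_exp, ← Real.rpow_def_of_pos (by positivity), ← Real.sqrt_eq_rpow,
        Real.sqrt_inv, div_eq_mul_inv _ ((√d : ℝ) : ℂ), ofReal_inv, mul_comm]
    congr 2
    push_cast
    ring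
  have e2 : (d ^ 2 / (1 + I * d * (0 : ℝ)) : ℂ) ^ (1 / 2 : ℂ) = d := by
    rw [ofReal_zero, mul_zero, add_zero, div_one, show (1 / 2 : ℂ) = ((2 : ℕ) : ℂ)⁻¹ by norm_num]
    exact pow_cpow_nat_inv (by simp) (by simp [Real.pi_pos])
      (by simp; positivity)
  have e3 : ((√d : ℝ) : ℂ) * √d = d := by
    rw [← ofReal_mul, Real.mul_self_sqrt hd'.le, ofReal_natCast]
  have e4 : ((√d : ℝ) : ℂ) ≠ 0 := by exact_mod_cast (Real.sqrt_pos.2 hd').ne'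
  rw [e1, e2, Complex.exp_neg, mul_one]
  have := Complex.exp_ne_zero (Real.pi * I / 4)
  field_simp
  linear_combination -e3

/-- Evaluation of the quadratic Gauss sum `∑ exp (π i k² / d)` for even `d`, over a multiple of its
period. -/
lemma sum_range_cexp_sq_div {d N : ℕ} (hd : 0 < d) (hd2 : Even d) (hN : 0 < N) (hdN : d ∣ N) :
    ∑ k ∈ Finset.range N, cexp (Real.pi * I * k ^ 2 / d) =
      (N / √d : ℝ) * cexp (Real.pi * I / 4) := by
  have : NeZero N := ⟨hN.ne'⟩
  have h1 := tendsto_sqrt_mul_tsum_cexp_near_rational hd hd2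
  have h2 : Tendsto (fun ε : ℝ ↦ ∑ k ∈ Finset.range N, cexp (Real.pi * I * k ^ 2 / d) *
      ((√ε : ℂ) * ∑' m : ℤ, cexp (-Real.pi * ε * (m * N + k) ^ 2))) (𝓝[>] 0)
      (𝓝 (∑ k ∈ Finset.range N, cexp (Real.pi * I * k ^ 2 / d) * (1 / N))) :=
    tendsto_finsetSum _ fun k _ ↦ (tendsto_sqrt_mul_tsum_gaussian_residue hN k).const_mul _
  have h3 := tendsto_nhds_unique_of_eventuallyEq h1 h2 ?_
  · rw [← Finset.sum_mul] at h3
    push_cast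
    field_simp at h3 ⊢
    linear_combination -h3
  filter_upwards [self_mem_nhdsWithin] with ε hε
  have hε : 0 < ε := hε
  rw [tsum_int_eq_sum_residues (N := N)
    (summable_cexp_neg_mul_int_sq (by simpa [div_natCast_re] using hε)), Finset.mul_sum]
  refine Finset.sum_congr rfl fun k _ ↦ ?_
  rw [mul_left_comm, ← tsum_mul_left (a := cexp _)]
  congr 2
  ext m
  rw [← Complex.exp_add, Complex.exp_eq_exp_iff_exists_int]
  obtain ⟨a, ha⟩ := hd2
  obtain ⟨b, hb⟩ := hdN
  refine ⟨m ^ 2 * a * b ^ 2 + m * b * k, ?_⟩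
  have ha' : (a : ℂ) = d / 2 := by rw [ha]; push_cast; ring
  push_cast
  rw [ha', hb]
  push_cast
  field_simp
  ring

/-- A symmetric integer matrix with even diagonal takes only even values. -/
lemma even_dotProduct_mulVec_self {ι : Type*} [Fintype ι] [DecidableEq ι] {M : Matrix ι ι ℤ}
    (hsym : M.IsSymm) (heven : ∀ i, Even (M i i)) (x : ι → ℤ) : Even (x ⬝ᵥ M *ᵥ x) := by
  rw [← ZMod.intCast_eq_zero_iff_even]
  have h : x ⬝ᵥ M *ᵥ x = ∑ p : ι × ι, x p.1 * (M p.1 p.2 * x p.2) := by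
    simp [dotProduct, mulVec, Finset.mul_sum, Fintype.sum_prod_type]
  rw [h, Int.cast_sum]
  refine Finset.sum_involution (fun p _ ↦ p.swap) (fun p _ ↦ ?_) (fun p _ hp hs ↦ hp ?_)
    (fun _ _ ↦ Finset.mem_univ _) (fun _ _ ↦ Prod.swap_swap _)
  · rw [← Int.cast_add, ZMod.intCast_eq_zero_iff_even]
    simp only [Prod.fst_swap, Prod.snd_swap, hsym.apply p.1 p.2]
    exact ⟨x p.1 * (M p.1 p.2 * x p.2), by ring⟩
  · have hs : p.2 = p.1 := congrArg Prod.fst hs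
    rw [ZMod.intCast_eq_zero_iff_even, hs]
    exact ((heven _).mul_right _).mul_left _

/-- A positive definite integral form is diagonalised by some finite-index sublattice. -/
lemma exists_transpose_mul_mul_eq_diagonal {n : ℕ} {M : Matrix (Fin n) (Fin n) ℤ}
    (hsym : M.IsSymm) (hpos : (M.map (Int.cast : ℤ → ℝ)).PosDef) :
    ∃ (P : Matrix (Fin n) (Fin n) ℤ) (d : Fin n → ℕ), (∀ i, 0 < d i) ∧
      Pᵀ * M * P = diagonal fun i ↦ (d i : ℤ) := by
  have : Invertible (2 : ℚ) := invertibleOfNonzero two_ne_zero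
  have hB : (Matrix.toBilin' (M.map (Int.cast : ℤ → ℚ))).IsSymm :=
    Matrix.isSymm_toBilin'_iff_isSymm.2 (hsym.map _)
  obtain ⟨v₀, hv₀⟩ := LinearMap.BilinForm.exists_orthogonal_basis
    (B := Matrix.toBilin' (M.map (Int.cast : ℤ → ℚ))) ⟨fun x y ↦ hB.eq x y⟩
  let σ : Fin n ≃ Fin (Module.finrank ℚ (Fin n → ℚ)) := finCongr (by simp)
  let v := v₀.reindex σ.symm
  have hv : ∀ i j, i ≠ j → Matrix.toBilin' (M.map (Int.cast : ℤ → ℚ)) (v i) (v j) = 0 := by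
    intro i j hij
    simpa [v] using hv₀ (σ.injective.ne hij)
  obtain ⟨b, hb⟩ := IsLocalization.exist_integer_multiples_of_finite (nonZeroDivisors ℤ)
    (fun p : Fin n × Fin n ↦ v p.2 p.1)
  choose p hp using hb
  have hb0 : ((b : ℤ) : ℚ) ≠ 0 := by exact_mod_cast nonZeroDivisors.coe_ne_zero b
  let P : Matrix (Fin n) (Fin n) ℤ := of fun i j ↦ p (i, j)
  have hP : ∀ i j, (P i j : ℚ) = b * v j i := fun i j ↦ by simpa [P] using hp (i, j)
  have hent : ∀ i j, (Pᵀ * M * P) i j = P.col i ⬝ᵥ M *ᵥ P.col j := by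
    intro i j
    rw [Matrix.mul_assoc]
    simp [Matrix.mul_apply, dotProduct, mulVec]
  have hoff : ∀ i j, i ≠ j → (Pᵀ * M * P) i j = 0 := by
    intro i j hij
    have h : (((Pᵀ * M * P) i j : ℤ) : ℚ) = b * (b * (v i ⬝ᵥ M.map (Int.cast : ℤ → ℚ) *ᵥ v j)) := by
      rw [hent]
      simp only [dotProduct, mulVec, Int.cast_sum, Int.cast_mul, Matrix.col_apply, hP, map_apply,
        Finset.mul_sum]
      refine Finset.sum_congr rfl fun _ _ ↦ Finset.sum_congr rfl fun _ _ ↦ by ring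
    have h0 := hv i j hij
    rw [Matrix.toBilin'_apply'] at h0
    rw [h0, mul_zero, mul_zero] at h
    exact_mod_cast h
  have hdiag : ∀ i, 0 < (Pᵀ * M * P) i i := by
    intro i
    have hx : (fun k ↦ (P k i : ℝ)) ≠ 0 := by
      intro h
      refine v.ne_zero i (funext fun k ↦ ?_)
      have h1 : (P k i : ℝ) = 0 := congrFun h k
      have h2 : (P k i : ℚ) = 0 := by exact_mod_cast h1
      rw [hP] at h2
      simpa [hb0] using h2
    have h := hpos.dotProduct_mulVec_pos hx
    rw [hent]
    have h' : ((P.col i ⬝ᵥ M *ᵥ P.col i : ℤ) : ℝ) =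
        star (fun k ↦ (P k i : ℝ)) ⬝ᵥ M.map (Int.cast : ℤ → ℝ) *ᵥ fun k ↦ (P k i : ℝ) := by
      simp [dotProduct, mulVec]
    rw [← h'] at h
    exact_mod_cast h
  refine ⟨P, fun i ↦ ((Pᵀ * M * P) i i).toNat, fun i ↦ by simpa using hdiag i, ?_⟩
  ext i j
  rcases eq_or_ne i j with rfl | hij
  · simp [(hdiag i).le]
  · rw [diagonal_apply_ne _ hij, hoff i j hij]

lemma sum_zmod_val {N : ℕ} [NeZero N] (g : ℕ → ℂ) :
    ∑ x : ZMod N, g x.val = ∑ k ∈ Finset.range N, g k := by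
  obtain ⟨m, rfl⟩ := Nat.exists_eq_succ_of_ne_zero (NeZero.ne N)
  exact Fin.sum_univ_eq_sum_range g (m + 1)

/-- The sum of an additive character of `ℤ / N` is `N` or `0`, according as the character is trivial
or not. -/
lemma sum_range_cexp_two_pi_mul {N : ℕ} {c : ℂ} (hc : ∃ q : ℤ, N * c = q) :
    ∑ k ∈ Finset.range N, cexp (2 * Real.pi * I * (k * c)) = N ∧ (∃ q : ℤ, c = q) ∨
      ∑ k ∈ Finset.range N, cexp (2 * Real.pi * I * (k * c)) = 0 := by
  have h : ∀ k : ℕ, cexp (2 * Real.pi * I * (k * c)) = cexp (2 * Real.pi * I * c) ^ k := fun k ↦ by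
    rw [← Complex.exp_nat_mul]; congr 1; ring
  simp_rw [h]
  by_cases h1 : cexp (2 * Real.pi * I * c) = 1
  · left
    refine ⟨by simp [h1], ?_⟩
    obtain ⟨q, hq⟩ := Complex.exp_eq_one_iff.1 h1
    refine ⟨q, mul_left_cancel₀ Complex.two_pi_I_ne_zero (hq.trans (mul_comm _ _))⟩
  · right
    obtain ⟨q, hq⟩ := hc
    rw [geom_sum_eq h1, ← h, hq, Complex.exp_eq_one_iff.2 ⟨q, mul_comm _ _⟩, sub_self, zero_div]

lemma nonneg_of_ofReal_mul_nonneg {r : ℝ} {z : ℂ} (hr : 0 < r) (h : 0 ≤ (r : ℂ) * z) : 0 ≤ z := by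
  rw [Complex.nonneg_iff, re_ofReal_mul, im_ofReal_mul] at h
  rw [Complex.nonneg_iff]
  exact ⟨nonneg_of_mul_nonneg_right h.1 hr, ((mul_eq_zero.1 h.2.symm).resolve_left hr.ne').symm⟩

/-- The Gauss sum of the discriminant form of a sublattice of an even unimodular lattice, in a
diagonalising basis, is a nonnegative real number. -/
lemma prod_sum_cexp_nonneg {n N : ℕ} [NeZero N] {M P : Matrix (Fin n) (Fin n) ℤ} {d : Fin n → ℕ}
    (hsym : M.IsSymm) (hdet : IsUnit M.det) (heven : ∀ i, Even (M i i)) (hd : ∀ i, 0 < d i)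
    (hd2 : ∀ i, Even (d i)) (hdN : ∀ i, d i ∣ N) (hP : Pᵀ * M * P = diagonal fun i ↦ (d i : ℤ)) :
    0 ≤ ∏ i, ∑ k ∈ Finset.range N, cexp (Real.pi * I * k ^ 2 / d i) := by
  have hdC : ∀ i, (d i : ℂ) ≠ 0 := fun i ↦ by exact_mod_cast (hd i).ne'
  let F : (Fin n → ℤ) → ℂ := fun y ↦ ∏ i, cexp (Real.pi * I * y i ^ 2 / d i)
  let rep : (Fin n → ZMod N) → Fin n → ℤ := fun x i ↦ (x i).val
  let X : Matrix (Fin n) (Fin n) ℂ :=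
    P.map (Int.cast : ℤ → ℂ) * diagonal fun i ↦ (d i : ℂ)⁻¹
  let c : (Fin n → ℤ) → Fin n → ℂ := fun y ↦ X *ᵥ fun i ↦ (y i : ℂ)
  have hc : ∀ y j, c y j = ∑ i, (P j i : ℂ) * y i / d i := by
    intro y j
    simp only [c, X, mulVec, dotProduct, mul_diagonal, map_apply]
    exact Finset.sum_congr rfl fun i _ ↦ by ring
  have hX1 : ((Pᵀ * M).map (Int.cast : ℤ → ℂ)) * X = 1 := by
    have h := congrArg (fun A ↦ A.map (Int.castRingHom ℂ)) hP
    simp only [Matrix.map_mul, diagonal_map (map_zero _)] at h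
    simp only [X, ← Matrix.mul_assoc]
    rw [show (Int.cast : ℤ → ℂ) = Int.castRingHom ℂ from rfl, Matrix.map_mul, h,
      diagonal_mul_diagonal, ← diagonal_one]
    congr 1
    ext i
    simp [hdC i]
  have hX2 : X * ((Pᵀ * M).map (Int.cast : ℤ → ℂ)) = 1 := mul_eq_one_comm.1 hX1
  have hcast : ∀ u : Fin n → ℤ, (fun i ↦ (((Pᵀ * M) *ᵥ u) i : ℂ)) =
      ((Pᵀ * M).map (Int.cast : ℤ → ℂ)) *ᵥ fun i ↦ (u i : ℂ) := by
    intro u; ext i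
    simp [mulVec, dotProduct]
  have hcross : ∀ y z, ∑ i, (y i : ℂ) * (Pᵀ *ᵥ z) i / d i = ∑ j, z j * c y j := by
    intro y z
    simp only [hc, mulVec, dotProduct, transpose_apply, Int.cast_sum, Int.cast_mul, Finset.mul_sum,
      Finset.sum_div]
    rw [Finset.sum_comm]
    exact Finset.sum_congr rfl fun _ _ ↦ Finset.sum_congr rfl fun _ _ ↦ by ring
  have hF1 : ∀ u, F (Pᵀ *ᵥ (M *ᵥ u)) = 1 := by
    intro u
    have h1 : c (Pᵀ *ᵥ (M *ᵥ u)) = fun i ↦ (u i : ℂ) := by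
      simp only [c, mulVec_mulVec]
      rw [hcast, mulVec_mulVec, hX2, one_mulVec]
    have h2 := hcross (Pᵀ *ᵥ (M *ᵥ u)) (M *ᵥ u)
    rw [h1] at h2
    obtain ⟨e, he⟩ := even_dotProduct_mulVec_self hsym heven u
    have h3 : ∑ j, ((M *ᵥ u) j : ℂ) * u j = e + e := by
      rw [dotProduct_comm] at he
      exact_mod_cast he
    rw [h3] at h2
    simp only [F]
    rw [← Complex.exp_sum, Complex.exp_eq_one_iff]
    refine ⟨e, ?_⟩
    calc _ = Real.pi * I * ∑ i, ((Pᵀ *ᵥ (M *ᵥ u)) i : ℂ) * ((Pᵀ *ᵥ (M *ᵥ u)) i) / d i := by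
          rw [Finset.mul_sum]
          exact Finset.sum_congr rfl fun _ _ ↦ by ring
      _ = _ := by rw [h2]; ring
  have hsurj : ∀ z, ∃ u, M *ᵥ u = z := fun z ↦
    ⟨M⁻¹ *ᵥ z, by rw [mulVec_mulVec, Matrix.mul_nonsing_inv _ hdet, one_mulVec]⟩
  have hFadd : ∀ y z, F (y + Pᵀ *ᵥ z) = F y * ∏ j, cexp (2 * Real.pi * I * (z j * c y j)) := by
    intro y z
    obtain ⟨u, rfl⟩ := hsurj z
    rw [← mul_one (F y), ← hF1 u]
    simp only [F, ← Complex.exp_sum, ← Complex.exp_add]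
    congr 1
    rw [← Finset.mul_sum, ← hcross, Finset.mul_sum, ← Finset.sum_add_distrib,
      ← Finset.sum_add_distrib]
    refine Finset.sum_congr rfl fun i _ ↦ ?_
    simp only [Pi.add_apply, Int.cast_add]
    ring
  have hFper : ∀ y y' : Fin n → ℤ, (∀ i, (y i : ZMod N) = y' i) → F y = F y' := by
    intro y y' h
    refine Finset.prod_congr rfl fun i _ ↦ ?_
    obtain ⟨m, hm⟩ := (ZMod.intCast_eq_intCast_iff_dvd_sub _ _ _).1 (h i).symm
    obtain ⟨b, hb⟩ := hdN i
    obtain ⟨a, ha⟩ := hd2 i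
    have ha' : (a : ℂ) = d i / 2 := by rw [ha]; push_cast; ring
    have hm' : (y i : ℂ) = y' i + N * m := by
      rw [eq_add_of_sub_eq' hm]; push_cast; ring
    rw [Complex.exp_eq_exp_iff_exists_int]
    refine ⟨a * b ^ 2 * m ^ 2 + y' i * b * m, ?_⟩
    have hN : (N : ℂ) = d i * b := by rw [hb]; push_cast; rfl
    have := hdC i
    push_cast
    rw [hm', hN, ha']
    field_simp
    ring
  have hS : ∏ i, ∑ k ∈ Finset.range N, cexp (Real.pi * I * k ^ 2 / d i) = ∑ x, F (rep x) := by
    simp_rw [← sum_zmod_val (N := N)]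
    rw [Finset.prod_univ_sum, Fintype.piFinset_univ]
    simp [F, rep]
  have hshift : ∀ w, ∑ x, F (rep x) =
      ∑ x, F (rep x) * ∏ j, cexp (2 * Real.pi * I * (rep w j * c (rep x) j)) := by
    intro w
    rw [← Equiv.sum_comp (Equiv.addRight fun i ↦ ((Pᵀ *ᵥ rep w) i : ZMod N))]
    refine Finset.sum_congr rfl fun x _ ↦ ?_
    rw [← hFadd]
    refine hFper _ _ fun i ↦ ?_
    simp [rep]
  have havg : (N ^ n : ℕ) * ∑ x, F (rep x) =
      ∑ x, F (rep x) * ∏ j, ∑ k ∈ Finset.range N, cexp (2 * Real.pi * I * (k * c (rep x) j)) := by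
    have h1 : ∑ _w : Fin n → ZMod N, ∑ x, F (rep x) = (N ^ n : ℕ) * ∑ x, F (rep x) := by
      simp [ZMod.card]
    rw [← h1, Finset.sum_congr rfl fun w _ ↦ hshift w, Finset.sum_comm]
    refine Finset.sum_congr rfl fun x _ ↦ ?_
    rw [← Finset.mul_sum]
    congr 1
    simp_rw [← sum_zmod_val (N := N)]
    rw [Finset.prod_univ_sum, Fintype.piFinset_univ]
    simp [rep]
  have hterm : ∀ x, 0 ≤ F (rep x) *
      ∏ j, ∑ k ∈ Finset.range N, cexp (2 * Real.pi * I * (k * c (rep x) j)) := by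
    intro x
    have hint : ∀ j, ∃ q : ℤ, N * c (rep x) j = q := by
      intro j
      refine ⟨∑ i, P j i * rep x i * ((N / d i : ℕ) : ℤ), ?_⟩
      rw [hc, Finset.mul_sum, Int.cast_sum]
      refine Finset.sum_congr rfl fun i _ ↦ ?_
      rw [Int.cast_mul, Int.cast_mul, Int.cast_natCast (N / d i), Nat.cast_div (hdN i) (hdC i)]
      ring
    by_cases h0 : ∃ j, ∑ k ∈ Finset.range N, cexp (2 * Real.pi * I * (k * c (rep x) j)) = 0
    · obtain ⟨j, hj⟩ := h0
      rw [Finset.prod_eq_zero (Finset.mem_univ j) hj, mul_zero]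
    push Not at h0
    have h1 := fun j ↦ (sum_range_cexp_two_pi_mul (hint j)).resolve_right (h0 j)
    choose hsum u hu using h1
    have hy : rep x = Pᵀ *ᵥ (M *ᵥ u) := by
      have h2 : (fun i ↦ (rep x i : ℂ)) = fun i ↦ (((Pᵀ * M) *ᵥ u) i : ℂ) := by
        rw [hcast, ← one_mulVec (fun i ↦ (rep x i : ℂ)), ← hX1, ← mulVec_mulVec]
        congr 1
        exact funext hu
      rw [mulVec_mulVec]
      ext i
      exact_mod_cast congrFun h2 i
    rw [Finset.prod_congr rfl fun j _ ↦ hsum j, hy, hF1, one_mul]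
    exact Finset.prod_nonneg fun _ _ ↦ Nat.cast_nonneg _
  rw [hS]
  have hpos : (0 : ℝ) < (N ^ n : ℕ) := by exact_mod_cast pow_pos (NeZero.pos N) n
  refine nonneg_of_ofReal_mul_nonneg hpos ?_
  rw [ofReal_natCast, havg]
  exact Finset.sum_nonneg fun x _ ↦ hterm x

/-- If a symmetric integer matrix is unimodular, even, and positive definite, then its
rank is divisible by 8. In particular there is no positive definite even unimodular
form on ℤⁿ for 0 < n < 8. -/
theorem rank_of_even_unimodular_posDef_form_dvd_eight
    {n : ℕ} (M : Matrix (Fin n) (Fin n) ℤ) (hsym : M.IsSymm)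
    (hdet : M.det = 1 ∨ M.det = -1)
    (heven : ∀ i, Even (M i i))
    (hpos : (M.map (Int.cast : ℤ → ℝ)).PosDef) :
    8 ∣ n := by
  obtain ⟨P, d, hd, hP⟩ := exists_transpose_mul_mul_eq_diagonal hsym hpos
  have hd2 : ∀ i, Even (d i) := by
    intro i
    rw [← Int.even_coe_nat]
    have h : (d i : ℤ) = P.col i ⬝ᵥ M *ᵥ P.col i := by
      have := congrFun (congrFun hP i) i
      rw [diagonal_apply_eq, Matrix.mul_assoc] at this
      rw [← this]
      simp [Matrix.mul_apply, dotProduct, mulVec]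
    rw [h]
    exact even_dotProduct_mulVec_self hsym heven _
  have hN : 0 < ∏ i, d i := Finset.prod_pos fun i _ ↦ hd i
  have hdN : ∀ i, d i ∣ ∏ j, d j := fun i ↦ Finset.dvd_prod_of_mem d (Finset.mem_univ i)
  have : NeZero (∏ i, d i) := ⟨hN.ne'⟩
  have hprod := prod_sum_cexp_nonneg hsym (Int.isUnit_iff.2 hdet) heven hd hd2 hdN hP
  simp_rw [fun i ↦ sum_range_cexp_sq_div (hd i) (hd2 i) hN (hdN i)] at hprod
  rw [Finset.prod_mul_distrib, Finset.prod_const, Finset.card_univ, Fintype.card_fin,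
    ← ofReal_prod] at hprod
  have hR : 0 < ∏ i, ((∏ j, d j : ℕ) / √(d i) : ℝ) := Finset.prod_pos fun i _ ↦
    div_pos (by exact_mod_cast hN) (Real.sqrt_pos.2 (by exact_mod_cast hd i))
  have hroot : 0 ≤ cexp (Real.pi * I / 4) ^ n :=
    nonneg_of_ofReal_mul_nonneg hR hprod
  have hone : cexp (Real.pi * I / 4) ^ n = 1 := by
    rw [Complex.eq_coe_norm_of_nonneg hroot, norm_pow, Complex.norm_exp]
    simp
  rw [← Complex.exp_nat_mul, Complex.exp_eq_one_iff] at hone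
  obtain ⟨m, hm⟩ := hone
  have h8 : (n : ℂ) = 8 * m := by
    refine mul_left_cancel₀ Complex.two_pi_I_ne_zero ?_
    linear_combination 8 * hm
  have h8' : (n : ℤ) = 8 * m := by exact_mod_cast h8
  omega
end
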